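/- Let X and A be finite nonempty alphabets with A ⊆ X, let θ : A → [0,1] with Σ_{a∈A} θ(a) = 1, let μ be the memoryless source μ(x_{1:n}) := ∏_{i=1}^n θ(x_i), and let n ≥ 1. Then for every x_{1:n} ∈ A^n with μ(x_{1:n}) > 0, −log₂( ξ(x_{1:n}) / μ(x_{1:n}) ) ≤ ((|A| + 1)/2)·log₂ n + |A|·log₂ |X| + |A| − 1, where ξ is the Sparse Sequential Dirichlet distribution over X. -/

import Mathlib

open Finset

/-- `cnt x i` is the number of occurrences of the symbol `x i` among `x 1, …, x (i-1)`,
i.e. the count `c(x_{1:i})` from the paper. -/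
def cnt {σ : Type*} [DecidableEq σ] (x : ℕ → σ) (i : ℕ) : ℕ :=
  ((Finset.Ico 1 i).filter (fun j => x j = x i)).card

/-- `seen x i` is the set `U(x_{<i})` of distinct symbols occurring in `x 1, …, x (i-1)`. -/
def seen {σ : Type*} [DecidableEq σ] (x : ℕ → σ) (i : ℕ) : Finset σ :=
  (Finset.Ico 1 i).image x

/-- The Sequential Dirichlet (Krichevsky–Trofimov) estimator over the alphabet `A`:
`ρ_A(x_{1:n}) = ∏_{i=1}^n (c(x_{1:i}) + 1/2) / (i + |A|/2 - 1)`. -/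
noncomputable def rho {σ : Type*} [DecidableEq σ] (A : Finset σ) (x : ℕ → σ) (n : ℕ) : ℝ :=
  ∏ i ∈ Finset.Icc 1 n, ((cnt x i : ℝ) + 1/2) / ((i : ℝ) + (A.card : ℝ)/2 - 1)

/-- The Sparse Sequential Dirichlet distribution over the alphabet `Xs`:
`ξ(x_{1:n}) = ∏_{i=1}^n f_i` where `f_i = (1/i)·(1/(|X| - |U(x_{<i})|))` if `c(x_{1:i}) = 0`
and `f_i = (1 - 1/i)·(c(x_{1:i}) + 1/2)/(i + |U(x_{<i})|/2 - 1)` otherwise. -/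
noncomputable def xi {σ : Type*} [DecidableEq σ] (Xs : Finset σ) (x : ℕ → σ) (n : ℕ) : ℝ :=
  ∏ i ∈ Finset.Icc 1 n,
    if cnt x i = 0 then
      (1/(i:ℝ)) * (1/((Xs.card : ℝ) - ((seen x i).card : ℝ)))
    else
      (1 - 1/(i:ℝ)) * (((cnt x i : ℝ) + 1/2) / ((i:ℝ) + ((seen x i).card : ℝ)/2 - 1))


lemma log_le_half {t : ℝ} (ht : 1 ≤ t) : Real.log t ≤ (t - t⁻¹) / 2 := by
  rw [← Real.sinh_log (by linarith)]
  exact Real.self_le_sinh_iff.2 (Real.log_nonneg ht)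

/-- rising factorial of one half -/
noncomputable def risingHalf (k : ℕ) : ℝ := ∏ j ∈ Finset.range k, ((j : ℝ) + 1/2)

lemma risingHalf_pos (k : ℕ) : 0 < risingHalf k :=
  Finset.prod_pos (fun j _ => by positivity)

lemma log_risingHalf (k : ℕ) : (k : ℝ) * Real.log k - k ≤ Real.log (risingHalf k) := by
  induction k with
  | zero => simp [risingHalf]
  | succ k ih =>
    have h1 : risingHalf (k+1) = risingHalf k * ((k:ℝ) + 1/2) := by
      simp [risingHalf, Finset.prod_range_succ]
    rw [h1, Real.log_mul (risingHalf_pos k).ne' (by positivity)]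
    push_cast
    rcases Nat.eq_zero_or_pos k with rfl | hk
    · have h2 : Real.log (1/2) = - Real.log 2 := by simp
      have := Real.log_two_lt_d9
      simp only [risingHalf, Finset.range_zero, Finset.prod_empty, Nat.cast_zero, zero_add,
        Real.log_one, h2]
      linarith
    · have hk' : (0:ℝ) < k := by exact_mod_cast hk
      set y : ℝ := (k:ℝ)
      have e1 : Real.log (y + 1/2) - Real.log y = Real.log ((y+1/2)/y) := by
        rw [Real.log_div (by positivity) (by positivity)]
      have e2 : Real.log (y + 1) - Real.log (y+1/2) = Real.log ((y+1)/(y+1/2)) := by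
        rw [Real.log_div (by positivity) (by positivity)]
      have b1 := log_le_half (t := (y+1/2)/y) (by rw [le_div_iff₀ hk']; linarith)
      have b2 := log_le_half (t := (y+1)/(y+1/2)) (by rw [le_div_iff₀ (by positivity)]; linarith)
      rw [← e1] at b1
      rw [← e2] at b2
      have c1 := mul_le_mul_of_nonneg_left b1 hk'.le
      have c2 := mul_le_mul_of_nonneg_left b2 (by positivity : (0:ℝ) ≤ y + 1)
      have c3 : y * (((y+1/2)/y - ((y+1/2)/y)⁻¹)/2)
          + (y+1) * (((y+1)/(y+1/2) - ((y+1)/(y+1/2))⁻¹)/2) = 1 := by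
        field_simp
        ring
      nlinarith

lemma gibbs_term (k n : ℕ) (hn : 1 ≤ n) (t : ℝ) (ht : 0 ≤ t) (hkt : k ≠ 0 → 0 < t) :
    (k:ℝ) * Real.log n + k * Real.log t - n * t ≤ Real.log (risingHalf k) := by
  have h := log_risingHalf k
  have hn' : (0:ℝ) < n := by exact_mod_cast hn
  rcases Nat.eq_zero_or_pos k with rfl | hk
  · simp only [Nat.cast_zero, zero_mul] at h ⊢
    have := mul_nonneg hn'.le ht
    linarith
  · have ht' := hkt hk.ne'
    have hk' : (0:ℝ) < k := by exact_mod_cast hk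
    have h2 := Real.log_le_sub_one_of_pos (x := n * t / k) (by positivity)
    rw [Real.log_div (by positivity) (by positivity), Real.log_mul (by positivity) (by positivity)] at h2
    have h3 := mul_le_mul_of_nonneg_left h2 hk'.le
    have h4 : (k:ℝ) * (n * t / k - 1) = n * t - k := by field_simp
    nlinarith

/-- number of occurrences of a letter among the first n symbols -/
def occ {σ : Type*} [DecidableEq σ] (x : ℕ → σ) (a : σ) (n : ℕ) : ℕ :=
  ((Finset.Icc 1 n).filter (fun j => x j = a)).card

lemma occ_succ {σ : Type*} [DecidableEq σ] (x : ℕ → σ) (a : σ) (n : ℕ) :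
    occ x a (n+1) = occ x a n + if x (n+1) = a then 1 else 0 := by
  unfold occ
  rw [← Finset.insert_Icc_right_eq_Icc_add_one (by omega), Finset.filter_insert]
  split_ifs
  · rw [Finset.card_insert_of_notMem (by simp)]
  · rfl

lemma cnt_succ {σ : Type*} [DecidableEq σ] (x : ℕ → σ) (n : ℕ) :
    cnt x (n+1) = occ x (x (n+1)) n := by
  unfold cnt occ
  congr 1

lemma prod_cnt {σ : Type*} [DecidableEq σ] (A : Finset σ) (x : ℕ → σ) (n : ℕ)
    (hx : ∀ i ∈ Finset.Icc 1 n, x i ∈ A) :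
    ∏ i ∈ Finset.Icc 1 n, ((cnt x i : ℝ) + 1/2) = ∏ a ∈ A, risingHalf (occ x a n) := by
  induction n with
  | zero => simp [occ, risingHalf]
  | succ n ih =>
    rw [Finset.prod_Icc_succ_top (by omega), ih (fun i hi => hx i (by
      simp only [Finset.mem_Icc] at hi ⊢; omega))]
    have h1 : ∀ a, risingHalf (occ x a (n+1)) = risingHalf (occ x a n) *
        if x (n+1) = a then ((cnt x (n+1) : ℝ) + 1/2) else 1 := by
      intro a
      rw [occ_succ]
      split_ifs with h
      · rw [cnt_succ, h]; simp [risingHalf, Finset.prod_range_succ]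
      · simp
    simp_rw [h1]
    rw [Finset.prod_mul_distrib, Finset.prod_ite_eq, if_pos (hx (n+1) (by simp))]

lemma log_prod_cnt {σ : Type*} [DecidableEq σ] (A : Finset σ) (θ : σ → ℝ)
    (hθ0 : ∀ a ∈ A, 0 ≤ θ a) (hsum : ∑ a ∈ A, θ a = 1)
    (n : ℕ) (hn : 1 ≤ n) (x : ℕ → σ) (hx : ∀ i ∈ Finset.Icc 1 n, x i ∈ A)
    (hmu : 0 < ∏ i ∈ Finset.Icc 1 n, θ (x i)) :
    (n:ℝ) * Real.log n - n + Real.log (∏ i ∈ Finset.Icc 1 n, θ (x i)) ≤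
      Real.log (∏ i ∈ Finset.Icc 1 n, ((cnt x i : ℝ) + 1/2)) := by
  have hne : ∀ i ∈ Finset.Icc 1 n, θ (x i) ≠ 0 := fun i hi =>
    Finset.prod_ne_zero_iff.1 hmu.ne' i hi
  rw [prod_cnt A x n hx, Real.log_prod (fun a _ => (risingHalf_pos _).ne'), Real.log_prod hne]
  have h1 : ∑ i ∈ Finset.Icc 1 n, Real.log (θ (x i)) =
      ∑ a ∈ A, (occ x a n : ℝ) * Real.log (θ a) := by
    rw [← Finset.sum_fiberwise_of_maps_to hx]
    refine Finset.sum_congr rfl (fun a _ => ?_)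
    rw [Finset.sum_congr rfl (g := fun _ => Real.log (θ a)) (fun i hi => by
      rw [(Finset.mem_filter.1 hi).2])]
    simp [occ]
  have h2 : (n:ℝ) = ∑ a ∈ A, (occ x a n : ℝ) := by
    have := Finset.card_eq_sum_card_fiberwise (f := x) (s := Finset.Icc 1 n) (t := A)
      (fun i hi => hx i hi)
    rw [Nat.card_Icc, Nat.add_sub_cancel] at this
    unfold occ
    exact_mod_cast this
  have h3 : ∀ a ∈ A, (occ x a n : ℝ) * Real.log n + occ x a n * Real.log (θ a) - n * θ a ≤
      Real.log (risingHalf (occ x a n)) := by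
    intro a ha
    refine gibbs_term _ n hn _ (hθ0 a ha) (fun h => ?_)
    obtain ⟨i, hi⟩ := Finset.card_pos.1 (Nat.pos_of_ne_zero h)
    rw [Finset.mem_filter] at hi
    refine lt_of_le_of_ne (hθ0 a ha) (fun h0 => hne i hi.1 ?_)
    rw [hi.2, ← h0]
  have h4 := Finset.sum_le_sum h3
  rw [Finset.sum_sub_distrib, Finset.sum_add_distrib, ← Finset.sum_mul, ← Finset.mul_sum, hsum,
    ← h2, ← h1] at h4
  linarith

lemma log_den (m n : ℕ) (hm : 2 ≤ m) (hn : 1 ≤ n) :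
    Real.log (∏ i ∈ Finset.Icc 1 n, ((i : ℝ) + (m : ℝ)/2 - 1)) ≤
      Real.log m - Real.log 2 + 1 + ((m:ℝ) - 1)/2 * Real.log n + n * Real.log n - n := by
  have hm' : (2:ℝ) ≤ m := by exact_mod_cast hm
  induction n, hn using Nat.le_induction with
  | base =>
    have : (1:ℝ) + (m:ℝ)/2 - 1 = m/2 := by ring
    simp [this, Real.log_div (by positivity : (m:ℝ) ≠ 0) (two_ne_zero)]
  | succ n hn ih =>
    have hn' : (1:ℝ) ≤ n := by exact_mod_cast hn
    rw [Finset.prod_Icc_succ_top (by omega), Real.log_mul]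
    · push_cast
      have e : (n:ℝ) + 1 + m/2 - 1 = n + m/2 := by ring
      rw [e]
      have a1 := Real.le_log_one_add_of_nonneg (x := 1/(n:ℝ)) (by positivity)
      have e1 : Real.log (1 + 1/(n:ℝ)) = Real.log (n+1) - Real.log n := by
        rw [← Real.log_div (by positivity) (by positivity)]
        congr 1; field_simp
      have e2 : 2 * (1/(n:ℝ)) / (1/(n:ℝ) + 2) = 1 / (n + 1/2) := by
        field_simp; ring
      rw [e1, e2] at a1
      have a2 := mul_le_mul_of_nonneg_left a1 (by linarith : (0:ℝ) ≤ n + (m-1)/2)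
      have e3 : ((n:ℝ) + (m-1)/2) * (1/(n+1/2)) = 1 + (m/2 - 1)/(n+1/2) := by
        field_simp; ring
      rw [e3] at a2
      have a3 := Real.log_le_sub_one_of_pos (x := ((n:ℝ) + m/2)/(n+1)) (by positivity)
      rw [Real.log_div (by positivity) (by positivity)] at a3
      have a4 : ((n:ℝ) + m/2)/(n+1) - 1 ≤ (m/2 - 1)/(n+1/2) := by
        have : ((n:ℝ) + m/2)/(n+1) - 1 = (m/2 - 1)/(n+1) := by field_simp; ring
        rw [this]
        apply div_le_div_of_nonneg_left <;> linarith
      nlinarith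
    · refine Finset.prod_ne_zero_iff.2 (fun i hi => ?_)
      have : (1:ℝ) ≤ i := by exact_mod_cast (Finset.mem_Icc.1 hi).1
      have : (0:ℝ) < (i:ℝ) + m/2 - 1 := by linarith
      exact this.ne'
    · push_cast
      have : (0:ℝ) < (n:ℝ) + 1 + m/2 - 1 := by linarith
      exact this.ne'

lemma den_pos {m i : ℕ} (hm : 1 ≤ m) (hi : 1 ≤ i) : (0:ℝ) < (i:ℝ) + (m:ℝ)/2 - 1 := by
  have : (1:ℝ) ≤ m := by exact_mod_cast hm
  have : (1:ℝ) ≤ i := by exact_mod_cast hi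
  linarith

lemma rho_pos {σ : Type*} [DecidableEq σ] (A : Finset σ) (hA : A.Nonempty) (x : ℕ → σ) (n : ℕ) :
    0 < rho A x n :=
  Finset.prod_pos (fun i hi => div_pos (by positivity)
    (den_pos hA.card_pos (Finset.mem_Icc.1 hi).1))

/-- the bound for the Sequential Dirichlet estimator -/
lemma log_rho {σ : Type*} [DecidableEq σ]
    (A : Finset σ) (hA : A.Nonempty) (θ : σ → ℝ)
    (hθ0 : ∀ a ∈ A, 0 ≤ θ a) (hθ1 : ∀ a ∈ A, θ a ≤ 1) (hsum : ∑ a ∈ A, θ a = 1)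
    (n : ℕ) (hn : 1 ≤ n) (x : ℕ → σ) (hx : ∀ i ∈ Finset.Icc 1 n, x i ∈ A)
    (hmu : 0 < ∏ i ∈ Finset.Icc 1 n, θ (x i)) :
    Real.log (∏ i ∈ Finset.Icc 1 n, θ (x i)) ≤ Real.log (rho A x n) +
      Real.log A.card + ((A.card:ℝ) - 1)/2 * Real.log n + ((A.card:ℝ) - 1) * Real.log 2 := by
  have hc : 1 ≤ A.card := hA.card_pos
  rcases Nat.lt_or_ge 1 A.card with h2 | h1
  · have a1 := log_prod_cnt A θ hθ0 hsum n hn x hx hmu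
    have a2 := log_den A.card n h2 hn
    have a3 : Real.log (rho A x n) = Real.log (∏ i ∈ Finset.Icc 1 n, ((cnt x i : ℝ) + 1/2)) -
        Real.log (∏ i ∈ Finset.Icc 1 n, ((i : ℝ) + (A.card : ℝ)/2 - 1)) := by
      unfold rho
      rw [Finset.prod_div_distrib, Real.log_div]
      · exact (Finset.prod_pos (fun i _ => by positivity)).ne'
      · exact (Finset.prod_pos (fun i hi => den_pos hc (Finset.mem_Icc.1 hi).1)).ne'
    have h2' : (2:ℝ) ≤ A.card := by exact_mod_cast h2
    have := Real.log_two_gt_d9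
    nlinarith
  · have hc1 : A.card = 1 := by omega
    obtain ⟨b, rfl⟩ := Finset.card_eq_one.1 hc1
    have hr : rho {b} x n = 1 := by
      unfold rho
      refine Finset.prod_eq_one (fun i hi => ?_)
      have h5 : cnt x i = i - 1 := by
        unfold cnt
        rw [Finset.filter_true_of_mem, Nat.card_Ico]
        intro j hj
        simp only [Finset.mem_Ico, Finset.mem_Icc] at hi hj
        rw [Finset.mem_singleton.1 (hx j (by simp; omega)),
          Finset.mem_singleton.1 (hx i (by simp; omega))]
      have hi1 := (Finset.mem_Icc.1 hi).1
      have hp := den_pos (m := 1) le_rfl hi1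
      rw [h5, Nat.cast_sub hi1]
      simp only [Finset.card_singleton] 
      rw [div_eq_one_iff_eq hp.ne']
      push_cast; ring
    have hle : ∏ i ∈ Finset.Icc 1 n, θ (x i) ≤ 1 :=
      Finset.prod_le_one (fun i hi => hθ0 _ (hx i hi)) (fun i hi => hθ1 _ (hx i hi))
    have := Real.log_nonpos hmu.le hle
    simpa [hr] using this

lemma seen_succ {σ : Type*} [DecidableEq σ] (x : ℕ → σ) (n : ℕ) (hn : 1 ≤ n) :
    seen x (n+1) = insert (x n) (seen x n) := by
  unfold seen
  rw [← Finset.image_insert, Finset.insert_Ico_right_eq_Ico_add_one hn]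

lemma cnt_zero_iff {σ : Type*} [DecidableEq σ] (x : ℕ → σ) (n : ℕ) :
    cnt x n = 0 ↔ x n ∉ seen x n := by
  unfold cnt seen
  rw [Finset.card_eq_zero, Finset.filter_eq_empty_iff]
  simp

/-- comparison of the sparse estimator with the Sequential Dirichlet estimator -/
lemma xi_ge {σ : Type*} [DecidableEq σ] (Xs A : Finset σ) (hA : A.Nonempty) (hAX : A ⊆ Xs)
    (x : ℕ → σ) (n : ℕ) (hn : 1 ≤ n) (hx : ∀ i ∈ Finset.Icc 1 n, x i ∈ A) :
    rho A x n * (A.card / (n * (Xs.card:ℝ) ^ (seen x (n+1)).card)) ≤ xi Xs x n := by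
  have hc : 1 ≤ A.card := hA.card_pos
  have hc' : (1:ℝ) ≤ A.card := by exact_mod_cast hc
  have hX : (A.card:ℝ) ≤ Xs.card := by exact_mod_cast Finset.card_le_card hAX
  have hX0 : (0:ℝ) < Xs.card := by linarith
  induction n, hn using Nat.le_induction with
  | base =>
    have e : (1:ℝ) + (A.card:ℝ)/2 - 1 = A.card/2 := by ring
    have h0 : cnt x 1 = 0 := by simp [cnt]
    have h1 : seen x (1+1) = {x 1} := by simp [seen]
    rw [h1]
    simp only [rho, xi, Finset.Icc_self, Finset.prod_singleton, h0]
    simp [e, seen]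
    apply le_of_eq
    field_simp
  | succ n hn ih =>
    have hn' : (1:ℝ) ≤ n := by exact_mod_cast hn
    have ih := ih (fun i hi => hx i (by simp only [Finset.mem_Icc] at hi ⊢; omega))
    have hsA : seen x (n+1) ⊆ A := by
      intro a ha
      obtain ⟨j, hj, rfl⟩ := Finset.mem_image.1 ha
      refine hx j ?_
      simp only [Finset.mem_Icc, Finset.mem_Ico] at hj ⊢; omega
    have hxA : x (n+1) ∈ A := hx _ (by simp)
    have hU : ((seen x (n+1)).card:ℝ) ≤ A.card := by exact_mod_cast Finset.card_le_card hsA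
    have hr : rho A x (n+1) = rho A x n * (((cnt x (n+1) : ℝ) + 1/2) / (n + (A.card:ℝ)/2)) := by
      unfold rho
      rw [Finset.prod_Icc_succ_top (by omega)]
      push_cast
      congr 2; ring
    have hrp := rho_pos A hA x n
    have hxi : xi Xs x (n+1) = xi Xs x n * (if cnt x (n+1) = 0 then
      (1/((n:ℝ)+1)) * (1/((Xs.card : ℝ) - ((seen x (n+1)).card : ℝ)))
    else
      (1 - 1/((n:ℝ)+1)) * (((cnt x (n+1) : ℝ) + 1/2) / ((n:ℝ) + ((seen x (n+1)).card : ℝ)/2))) := by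
      unfold xi
      rw [Finset.prod_Icc_succ_top (by omega)]
      push_cast
      have : (n:ℝ) + 1 + ((seen x (n+1)).card : ℝ)/2 - 1 = n + ((seen x (n+1)).card : ℝ)/2 := by
        ring
      rw [this]
    rw [hr, hxi, seen_succ x (n+1) (by omega)]
    have hstart : 0 ≤ rho A x n * (A.card / (n * (Xs.card:ℝ) ^ (seen x (n+1)).card)) := by
      positivity
    by_cases h0 : cnt x (n+1) = 0
    · have hns := (cnt_zero_iff x (n+1)).1 h0
      have hlt : ((seen x (n+1)).card:ℝ) + 1 ≤ Xs.card := by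
        have := Finset.card_le_card ((Finset.insert_subset hxA hsA).trans hAX)
        rw [Finset.card_insert_of_notMem hns] at this
        exact_mod_cast this
      rw [if_pos h0, Finset.card_insert_of_notMem hns, h0]
      set u := (seen x (n+1)).card
      have key : (n/(n+1)) * (1/(Xs.card:ℝ)) * ((1/2) / (n + (A.card:ℝ)/2)) ≤
          (1/((n:ℝ)+1)) * (1/((Xs.card : ℝ) - (u : ℝ))) := by
        have k1 : (n/(n+1)) * (1/(Xs.card:ℝ)) * ((1/2) / (n + (A.card:ℝ)/2)) =
          (1/((n:ℝ)+1)) * ((1/(Xs.card:ℝ)) * (n * (1/2) / (n + (A.card:ℝ)/2))) := by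
          ring
        rw [k1]
        apply mul_le_mul_of_nonneg_left _ (by positivity)
        calc (1/(Xs.card:ℝ)) * (n * (1/2) / (n + (A.card:ℝ)/2)) ≤ (1/(Xs.card:ℝ)) * 1 := by
              apply mul_le_mul_of_nonneg_left _ (by positivity)
              rw [div_le_one (by positivity)]
              linarith
          _ ≤ _ := by
              rw [mul_one]
              apply one_div_le_one_div_of_le
              · linarith
              · have : (0:ℝ) ≤ u := by positivity
                linarith
      refine le_trans (le_of_eq ?_) (mul_le_mul ih key (by positivity) (hstart.trans ih))
      push_cast
      rw [pow_succ]
      field_simp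
      try ring
    · have hs : x (n+1) ∈ seen x (n+1) := by
        by_contra h
        exact h0 ((cnt_zero_iff x (n+1)).2 h)
      rw [if_neg h0, Finset.insert_eq_of_mem hs]
      set u := (seen x (n+1)).card
      have key : (n/((n:ℝ)+1)) * (((cnt x (n+1) : ℝ) + 1/2) / (n + (A.card:ℝ)/2)) ≤
          (1 - 1/((n:ℝ)+1)) * (((cnt x (n+1) : ℝ) + 1/2) / ((n:ℝ) + (u : ℝ)/2)) := by
        have : 1 - 1/((n:ℝ)+1) = n/((n:ℝ)+1) := by field_simp; ring
        rw [this]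
        gcongr
      refine le_trans (le_of_eq ?_) (mul_le_mul ih key (by positivity) (hstart.trans ih))
      push_cast
      field_simp

/-- Overall redundancy of the Sparse Sequential Dirichlet distribution relative to a
memoryless source `μ(x₁..xₙ) = ∏ᵢ θ(xᵢ)` over `A ⊆ X`:
`-log₂(ξ(x₁..xₙ)/μ(x₁..xₙ)) ≤ ((|A|+1)/2)·log₂ n + |A|·log₂ |X| + |A| - 1`
whenever `μ(x₁..xₙ) > 0`. -/
theorem sparse_dirichlet_overall_redundancy {σ : Type*} [DecidableEq σ]
    (Xs A : Finset σ) (hA : A.Nonempty) (hAX : A ⊆ Xs) (θ : σ → ℝ)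
    (hθ0 : ∀ a ∈ A, 0 ≤ θ a) (hθ1 : ∀ a ∈ A, θ a ≤ 1)
    (hsum : ∑ a ∈ A, θ a = 1)
    (n : ℕ) (hn : 1 ≤ n) (x : ℕ → σ) (hx : ∀ i ∈ Finset.Icc 1 n, x i ∈ A)
    (hmu : 0 < ∏ i ∈ Finset.Icc 1 n, θ (x i)) :
    -Real.logb 2 (xi Xs x n / ∏ i ∈ Finset.Icc 1 n, θ (x i)) ≤
      ((A.card : ℝ) + 1) / 2 * Real.logb 2 (n : ℝ)
        + (A.card : ℝ) * Real.logb 2 (Xs.card : ℝ) + (A.card : ℝ) - 1 := by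
  have hc : 1 ≤ A.card := hA.card_pos
  have hc' : (1:ℝ) ≤ A.card := by exact_mod_cast hc
  have hX : (A.card:ℝ) ≤ Xs.card := by exact_mod_cast Finset.card_le_card hAX
  have hX1 : (1:ℝ) ≤ Xs.card := by linarith
  have hn' : (1:ℝ) ≤ n := by exact_mod_cast hn
  have hrp := rho_pos A hA x n
  have hxi := xi_ge Xs A hA hAX x n hn hx
  have hpos : 0 < rho A x n * (A.card / (n * (Xs.card:ℝ) ^ (seen x (n+1)).card)) := by
    positivity
  have hxip := hpos.trans_le hxi
  have hlog := Real.log_le_log hpos hxi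
  rw [Real.log_mul (by positivity) (by positivity), Real.log_div (by positivity) (by positivity),
    Real.log_mul (by positivity) (by positivity), Real.log_pow] at hlog
  have hs : ((seen x (n+1)).card : ℝ) ≤ A.card := by
    have : seen x (n+1) ⊆ A := by
      intro a ha
      obtain ⟨j, hj, rfl⟩ := Finset.mem_image.1 ha
      refine hx j ?_
      simp only [Finset.mem_Icc, Finset.mem_Ico] at hj ⊢; omega
    exact_mod_cast Finset.card_le_card this
  have hs2 := mul_le_mul_of_nonneg_right hs (Real.log_nonneg hX1)
  have hr := log_rho A hA θ hθ0 hθ1 hsum n hn x hx hmu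
  have h2 : 0 < Real.log 2 := Real.log_pos (by norm_num)
  rw [Real.logb, Real.logb, Real.logb, Real.log_div hxip.ne' hmu.ne']
  have e : ((A.card : ℝ) + 1) / 2 * (Real.log n / Real.log 2)
        + (A.card : ℝ) * (Real.log Xs.card / Real.log 2) + (A.card : ℝ) - 1 =
      (((A.card : ℝ) + 1) / 2 * Real.log n + A.card * Real.log Xs.card
        + ((A.card:ℝ) - 1) * Real.log 2) / Real.log 2 := by
    field_simp
    ring
  rw [e, ← neg_div]
  apply div_le_div_of_nonneg_right _ h2.le
  linarith
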